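/- (Monotonicity) Let X be an assignment to the indeterminates and let C →ʳ C' be a step in TA_{ξ_i}[X] such that the rule r belongs to the gadget TA_{A_i^j} for some j. Then for every configuration D with C ⪯_{A_i^j} D, there exists a configuration D' such that D →ʳ D' is a step in TA_{ξ_i}[X] and C' ⪯_{A_i^j} D'. -/

import Mathlib

namespace ThresholdAutomata

/-- A comparison operator `⋈ ∈ {<, ≤, =, >, ≥}`. -/
inductive CmpOp : Type
  | lt | le | eq | gt | ge

/-- Interpretation of a comparison operator on `ℕ`. -/
def CmpOp.holds : CmpOp → ℕ → ℕ → Prop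
  | .lt, a, b => a < b
  | .le, a, b => a ≤ b
  | .eq, a, b => a = b
  | .gt, a, b => a > b
  | .ge, a, b => a ≥ b

/-- A linear polynomial with `ℕ` coefficients over the variables
`x₁, …, xₙ, y₁, …, y_m`. -/
structure LinPoly (n m : ℕ) where
  xcoeff : Fin n → ℕ
  ycoeff : Fin m → ℕ
  const : ℕ

/-- The value of a linear polynomial at assignments `X` and `Y`. -/
def LinPoly.eval {n m : ℕ} (f : LinPoly n m) (X : Fin n → ℕ) (Y : Fin m → ℕ) : ℕ :=
  ∑ i, f.xcoeff i * X i + ∑ j, f.ycoeff j * Y j + f.const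

/-- An atom: either a divisibility constraint `x_j | y_k` or an atomic
Presburger formula `f(x,y) ⋈ g(x,y)`. -/
inductive Atom (n m : ℕ) : Type
  | div (j : Fin n) (k : Fin m)
  | cmp (f g : LinPoly n m) (op : CmpOp)

/-- Truth of an atom at assignments `X`, `Y` over `ℕ`. -/
def Atom.holds {n m : ℕ} (X : Fin n → ℕ) (Y : Fin m → ℕ) : Atom n m → Prop
  | .div j k => X j ∣ Y k
  | .cmp f g op => op.holds (f.eval X Y) (g.eval X Y)

/-- Whether an atom is a divisibility constraint (only those have an
associated environment variable `d_A`). -/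
def Atom.IsDiv {n m : ℕ} : Atom n m → Prop
  | .div _ _ => True
  | .cmp _ _ _ => False

/-- A configuration of the chained sketch `TA_{ξ_i}` built from the atoms
`A_i^1, …, A_i^l` (after substituting values for the indeterminates).
The gadget of the `a`-th atom has the locations `(a, 0) = start_{A_i^a}`,
`(a, 1) = ℓ_{A_i^a}`, `(a, 2) = end_{A_i^a}` and the shared variable `v a`;
the environment variables are `t₁, …, t_m`, one `d a` per (divisibility) atom,
and `z`, the total number of processes (the number function is `N = z`). -/
structure Config (l m : ℕ) where
  κ : Fin l × Fin 3 → ℕ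
  v : Fin l → ℕ
  t : Fin m → ℕ
  d : Fin l → ℕ
  z : ℕ

/-- Moving one process from location `p` to location `q`. -/
def move {α : Type*} [DecidableEq α] (κ : α → ℕ) (p q : α) : α → ℕ :=
  Function.update (Function.update κ p (κ p - 1)) q (κ q + 1)

/-- The guard of the rule from `ℓ_A` to `end_A` for the atom `A` at position `a`:
`v_A = s_j·d_A ∧ v_A = t_k` in the divisibility case and
`v_A = f(s,t) ∧ v_A ⋈ g(s,t)` in the atomic case, where the indeterminates `s`
have the values `X`. -/
def guardHolds {n m l : ℕ} (atoms : Fin l → Atom n m) (X : Fin n → ℕ)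
    (a : Fin l) (C : Config l m) : Prop :=
  match atoms a with
  | .div j k => C.v a = X j * C.d a ∧ C.v a = C.t k
  | .cmp f g op => C.v a = f.eval X C.t ∧ op.holds (C.v a) (g.eval X C.t)

/-- The rules of `TA_{ξ_i}`: for each atom position `a`, the two unguarded rules
from `start_{A^a}` to `ℓ_{A^a}` (`inc a` increments `v_A`, `skip a` increments
nothing), the guarded non-incrementing rule `fin a` from `ℓ_{A^a}` to `end_{A^a}`,
and the unguarded non-incrementing linking rule `link a` from `end_{A^a}` to
`start_{A^{a+1}}`. -/
inductive Rule (l : ℕ) : Type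
  | inc (a : Fin l)
  | skip (a : Fin l)
  | fin (a : Fin l)
  | link (a : Fin l)

/-- A rule belongs to the gadget `TA_A` of the atom at position `a`
(the linking rules belong to no gadget). -/
def Rule.belongsTo {l : ℕ} : Rule l → Fin l → Prop
  | .inc b, a => b = a
  | .skip b, a => b = a
  | .fin b, a => b = a
  | .link _, _ => False

/-- `Fires atoms X r C C'` says that in `TA_{ξ_i}[X]` the rule `r` is enabled at
the configuration `C` and firing it produces the configuration `C'`. -/
def Fires {n m l : ℕ} (atoms : Fin l → Atom n m) (X : Fin n → ℕ) :
    Rule l → Config l m → Config l m → Prop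
  | .inc a, C, C' => 0 < C.κ (a, 0) ∧
      C' = ⟨move C.κ (a, 0) (a, 1), Function.update C.v a (C.v a + 1), C.t, C.d, C.z⟩
  | .skip a, C, C' => 0 < C.κ (a, 0) ∧
      C' = ⟨move C.κ (a, 0) (a, 1), C.v, C.t, C.d, C.z⟩
  | .fin a, C, C' => 0 < C.κ (a, 1) ∧ guardHolds atoms X a C ∧
      C' = ⟨move C.κ (a, 1) (a, 2), C.v, C.t, C.d, C.z⟩
  | .link a, C, C' => ∃ h : (a : ℕ) + 1 < l, 0 < C.κ (a, 2) ∧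
      C' = ⟨move C.κ (a, 2) (⟨(a : ℕ) + 1, h⟩, 0), C.v, C.t, C.d, C.z⟩

/-- The step relation of `TA_{ξ_i}[X]`. -/
def Step {n m l : ℕ} (atoms : Fin l → Atom n m) (X : Fin n → ℕ)
    (C C' : Config l m) : Prop :=
  ∃ r : Rule l, Fires atoms X r C C'

/-- The relation `C ⪯_A D` for the atom `A` at position `a`: `C` and `D` agree on
`v_A`, on `d_A` (when `A` is a divisibility atom, so that `d_A` exists) and on
`t₁, …, t_m`, and `C(v) ≤ D(v)` for `v ∈ {start_A, ℓ_A, end_A, z}`. -/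
def Pre {n m l : ℕ} (atoms : Fin l → Atom n m) (a : Fin l)
    (C D : Config l m) : Prop :=
  C.v a = D.v a ∧ ((atoms a).IsDiv → C.d a = D.d a) ∧ (∀ i, C.t i = D.t i) ∧
  (∀ pos : Fin 3, C.κ (a, pos) ≤ D.κ (a, pos)) ∧ C.z ≤ D.z


/-- Moving a process preserves the order on the locations of one gadget. -/
theorem move_mono {l : ℕ} (a : Fin l) (κ κ' : Fin l × Fin 3 → ℕ) (p q : Fin 3)
    (h : ∀ pos : Fin 3, κ (a, pos) ≤ κ' (a, pos)) (pos : Fin 3) :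
    move κ (a, p) (a, q) (a, pos) ≤ move κ' (a, p) (a, q) (a, pos) := by
  have h1 := h p
  have h2 := h q
  have h3 := h pos
  simp only [move, Function.update_apply, Prod.mk.injEq, true_and]
  split_ifs <;> omega

/-- The guard of a gadget only depends on the variables fixed by `Pre`. -/
theorem guard_mono {n m l : ℕ} (atoms : Fin l → Atom n m) (X : Fin n → ℕ)
    (a : Fin l) (C D : Config l m) (hCD : Pre atoms a C D)
    (h : guardHolds atoms X a C) : guardHolds atoms X a D := by
  obtain ⟨hv, hd, ht, -, -⟩ := hCD
  have ht' : C.t = D.t := funext ht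
  unfold guardHolds at *
  cases hA : atoms a with
  | div j k =>
    rw [hA] at hd
    simp only [hA] at h ⊢
    rw [← hv, ← hd trivial, ← ht']
    exact h
  | cmp f g op =>
    simp only [hA] at h ⊢
    rw [← hv, ← ht']
    exact h

/-- **Monotonicity (Proposition 1)**: if `C →ʳ C'` is a step of `TA_{ξ_i}[X]`
whose rule `r` belongs to the gadget `TA_{A_i^j}` of the atom at position `a`,
then for every configuration `D` with `C ⪯_{A_i^j} D` there is a configuration
`D'` such that `D →ʳ D'` is a step of `TA_{ξ_i}[X]` and `C' ⪯_{A_i^j} D'`. -/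
theorem monotonicity {n m l : ℕ} (atoms : Fin l → Atom n m) (X : Fin n → ℕ)
    (r : Rule l) (a : Fin l) (C C' D : Config l m)
    (hr : r.belongsTo a) (hstep : Fires atoms X r C C') (hCD : Pre atoms a C D) :
    ∃ D' : Config l m, Fires atoms X r D D' ∧ Pre atoms a C' D' := by
  have hCD' := hCD
  obtain ⟨hv, hd, ht, hκ, hz⟩ := hCD
  cases r with
  | inc b =>
    obtain rfl : b = a := hr
    obtain ⟨h0, rfl⟩ := hstep
    refine ⟨_, ⟨lt_of_lt_of_le h0 (hκ 0), rfl⟩, ?_, hd, ht, move_mono b _ _ 0 1 hκ, hz⟩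
    simp [hv]
  | skip b =>
    obtain rfl : b = a := hr
    obtain ⟨h0, rfl⟩ := hstep
    exact ⟨_, ⟨lt_of_lt_of_le h0 (hκ 0), rfl⟩, hv, hd, ht, move_mono b _ _ 0 1 hκ, hz⟩
  | fin b =>
    obtain rfl : b = a := hr
    obtain ⟨h0, hg, rfl⟩ := hstep
    exact ⟨_, ⟨lt_of_lt_of_le h0 (hκ 1), guard_mono atoms X b C D hCD' hg, rfl⟩,
      hv, hd, ht, move_mono b _ _ 1 2 hκ, hz⟩
  | link b => exact hr.elim

end ThresholdAutomata
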